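/- Let V be a finite-dimensional real inner product space, X ∈ V, and let F be the Kropina metric F(u) = ⟨u,u⟩/⟨X,u⟩ with fundamental tensor g_y. Then for all orthonormal y, v ∈ V with ⟨X,y⟩ > 0, writing F = F(y) = 1/⟨X,y⟩, one has g_y(y,y)·g_y(v,v) − g_y(y,v)² = 2F⁴(F²⟨X,v⟩² + 1). -/

import Mathlib

open scoped RealInnerProductSpace

/-- The Kropina metric `F(u) = ⟨u,u⟩ / ⟨X,u⟩` on a real inner product space. -/
noncomputable def kropinaMetric {V : Type*} [NormedAddCommGroup V]
    [InnerProductSpace ℝ V] (X : V) (u : V) : ℝ :=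
  ⟪u, u⟫ / ⟪X, u⟫

/-- The fundamental tensor of a Finsler norm `F` at `y`:
`g_y(u,w) = (1/2) ∂²/∂s∂t [F(y + s u + t w)²]` at `s = t = 0`. -/
noncomputable def fundamentalTensor {V : Type*} [NormedAddCommGroup V]
    [InnerProductSpace ℝ V] (F : V → ℝ) (y u w : V) : ℝ :=
  (1 / 2) * deriv (fun s : ℝ => deriv (fun t : ℝ => (F (y + s • u + t • w)) ^ 2) 0) 0

section

variable {V : Type*} [NormedAddCommGroup V] [InnerProductSpace ℝ V]

/-- The derivative of a real inner product along the line `z + t • w`. -/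
theorem hasDerivAt_inner_line (x z w : V) :
    HasDerivAt (fun t : ℝ => ⟪x, z + t • w⟫) ⟪x, w⟫ 0 := by
  simp only [inner_add_right, inner_smul_right]
  simpa using ((hasDerivAt_id (0 : ℝ)).mul_const ⟪x, w⟫).const_add ⟪x, z⟫

theorem hasDerivAt_inner_self_line (z w : V) :
    HasDerivAt (fun t : ℝ => ⟪z + t • w, z + t • w⟫) (2 * ⟪z, w⟫) 0 := by
  have h : HasDerivAt (fun t : ℝ => z + t • w) w 0 := by
    simpa using ((hasDerivAt_id (0 : ℝ)).smul_const w).const_add z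
  refine (h.inner ℝ h).congr_deriv ?_
  simp [real_inner_comm z w]
  ring

/-- The directional derivative of the squared Kropina metric. -/
theorem hasDerivAt_kropinaMetric_sq (X z w : V) (hz : ⟪X, z⟫ ≠ 0) :
    HasDerivAt (fun t : ℝ => kropinaMetric X (z + t • w) ^ 2)
      (4 * ⟪z, z⟫ * ⟪z, w⟫ / ⟪X, z⟫ ^ 2 - 2 * ⟪z, z⟫ ^ 2 * ⟪X, w⟫ / ⟪X, z⟫ ^ 3) 0 := by
  have h := ((hasDerivAt_inner_self_line z w).fun_div (hasDerivAt_inner_line X z w)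
    (by simpa using hz)).fun_pow 2
  unfold kropinaMetric
  refine h.congr_deriv ?_
  simp only [zero_smul, add_zero, Nat.reduceSub, pow_one]
  field_simp
  ring

/-- The fundamental tensor of the Kropina metric in closed form. -/
theorem fundamentalTensor_kropinaMetric (X y u w : V) (hy : ⟪X, y⟫ ≠ 0) :
    fundamentalTensor (kropinaMetric X) y u w =
      (4 * ⟪y, u⟫ * ⟪y, w⟫ + 2 * ⟪y, y⟫ * ⟪u, w⟫) / ⟪X, y⟫ ^ 2 -
        4 * ⟪y, y⟫ * (⟪y, w⟫ * ⟪X, u⟫ + ⟪y, u⟫ * ⟪X, w⟫) / ⟪X, y⟫ ^ 3 +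
        3 * ⟪y, y⟫ ^ 2 * ⟪X, u⟫ * ⟪X, w⟫ / ⟪X, y⟫ ^ 4 := by
  have hL := hasDerivAt_inner_line X y u
  have hN := hasDerivAt_inner_self_line y u
  have hW : HasDerivAt (fun s : ℝ => ⟪y + s • u, w⟫) ⟪u, w⟫ 0 := by
    simpa only [real_inner_comm w] using hasDerivAt_inner_line w y u
  have hne : ∀ᶠ s in nhds (0 : ℝ), ⟪X, y + s • u⟫ ≠ 0 :=
    hL.continuousAt.eventually_ne (by simpa using hy)
  have heq := hne.mono fun s hs => (hasDerivAt_kropinaMetric_sq X (y + s • u) w hs).deriv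
  have h := (((hN.const_mul 4).fun_mul hW).fun_div (hL.fun_pow 2) (by simpa using hy)).fun_sub
    ((((hN.fun_pow 2).const_mul 2).mul_const ⟪X, w⟫).fun_div (hL.fun_pow 3) (by simpa using hy))
  rw [fundamentalTensor, Filter.EventuallyEq.deriv_eq heq, h.deriv]
  simp only [zero_smul, add_zero, Nat.reduceSub, pow_one]
  field_simp
  ring

end

/-- Let `V` be a finite-dimensional real inner product space,
`X ∈ V`, and `F` the Kropina metric with fundamental tensor `g_y`. For orthonormal
`y, v` with `⟨X,y⟩ > 0`, writing `F = F(y) = 1/⟨X,y⟩`, one has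
`g_y(y,y) g_y(v,v) − g_y(y,v)² = 2F⁴(F²⟨X,v⟫² + 1)`. -/
theorem kropina_fundamental_tensor_determinant
    {V : Type*} [NormedAddCommGroup V] [InnerProductSpace ℝ V]
    [FiniteDimensional ℝ V]
    (X : V)
    (y v : V) (hy : ⟪y, y⟫ = 1) (hv : ⟪v, v⟫ = 1) (hyv : ⟪y, v⟫ = 0)
    (hXy : 0 < ⟪X, y⟫)
    (F : ℝ) (hF : F = 1 / ⟪X, y⟫) :
    fundamentalTensor (kropinaMetric X) y y y *
          fundamentalTensor (kropinaMetric X) y v v -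
        (fundamentalTensor (kropinaMetric X) y y v) ^ 2 =
      2 * F ^ 4 * (F ^ 2 * ⟪X, v⟫ ^ 2 + 1) := by
  have hne := hXy.ne'
  simp only [fundamentalTensor_kropinaMetric X y _ _ hne, hy, hv, hyv, hF]
  field_simp
  ring
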